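/- Schatten class membership (Proposition thmSchayyen): let α > -1, β, η > 0, y > 0, and let p be a real number with p > 4/(1+2η). Then the series Σ_{n=0}^∞ (π γ_n^{β,η} φ_n^α(y)²)^{p/2} converges; consequently S_y^α : L^{2,α}(ℝ_+; ℍ) → A^{2,β,η}_slice is a Schatten operator of class p. -/

import Mathlib

open MeasureTheory Real

/-- Generalized Laguerre polynomial `L_n^{(α)}(x)`. -/
noncomputable def genLaguerre (α : ℝ) (n : ℕ) (x : ℝ) : ℝ :=
  ∑ k ∈ Finset.range (n + 1),
    ((-1 : ℝ) ^ k / (Nat.factorial k)) *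
      (Real.Gamma (n + α + 1) / (Real.Gamma (k + α + 1) * (Nat.factorial (n - k)))) * x ^ k

/-- Normalized Laguerre function `φ_n^α(x)`. -/
noncomputable def lagPhi (α : ℝ) (n : ℕ) (x : ℝ) : ℝ :=
  Real.sqrt ((Nat.factorial n : ℝ) / Real.Gamma (n + α + 1)) * genLaguerre α n x

/-- `γ_n^{β,η} = Γ(η)Γ(β+n)/Γ(β+η+n)`. -/
noncomputable def gamCoef (β η : ℝ) (n : ℕ) : ℝ :=
  Real.Gamma η * Real.Gamma (β + n) / Real.Gamma (β + η + n)

/-- Zero-extended coefficients of the Laguerre polynomials. -/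
noncomputable def lagC (α : ℝ) (n k : ℕ) : ℝ :=
  if k ≤ n then ((-1 : ℝ) ^ k / (Nat.factorial k)) *
      (Real.Gamma (n + α + 1) / (Real.Gamma (k + α + 1) * (Nat.factorial (n - k)))) else 0

lemma genLaguerre_eq (α : ℝ) (n N : ℕ) (h : n + 1 ≤ N) (x : ℝ) :
    genLaguerre α n x = ∑ k ∈ Finset.range N, lagC α n k * x ^ k := by
  have h1 : genLaguerre α n x = ∑ k ∈ Finset.range (n + 1), lagC α n k * x ^ k := by
    unfold genLaguerre
    apply Finset.sum_congr rfl
    intro k hk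
    rw [Finset.mem_range] at hk
    rw [lagC, if_pos (by omega)]
  rw [h1]
  apply Finset.sum_subset
  · intro k hk
    rw [Finset.mem_range] at *
    omega
  · intro k _ hk
    rw [Finset.mem_range] at hk
    rw [lagC, if_neg (by omega), zero_mul]

lemma Gamma_step (α : ℝ) (hα : -1 < α) (n : ℕ) :
    Real.Gamma ((n + 1 : ℕ) + α + 1) = (n + α + 1) * Real.Gamma (n + α + 1) := by
  have hn : (0 : ℝ) ≤ n := Nat.cast_nonneg n
  rw [← Real.Gamma_add_one (by linarith)]
  congr 1
  push_cast
  ring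

lemma Gamma_pos_aux (α : ℝ) (hα : -1 < α) (n : ℕ) : 0 < Real.Gamma (n + α + 1) := by
  have hn : (0 : ℝ) ≤ n := Nat.cast_nonneg n
  exact Real.Gamma_pos_of_pos (by linarith)

lemma lagC_zero (α : ℝ) (hα : -1 < α) (n : ℕ) :
    (n + 2 : ℝ) * lagC α (n + 2) 0 = (2 * n + 3 + α) * lagC α (n + 1) 0
      - (n + 1 + α) * lagC α n 0 := by
  have h0 := Gamma_pos_aux α hα n
  have h1 := Gamma_pos_aux α hα 0
  have hf : (0 : ℝ) < n.factorial := by exact_mod_cast Nat.factorial_pos n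
  have hn : (0 : ℝ) ≤ n := Nat.cast_nonneg n
  simp only [lagC, Nat.zero_le, if_true, Nat.sub_zero, Gamma_step α hα (n + 1), Gamma_step α hα n,
    Nat.factorial_succ, Nat.cast_mul]
  generalize Real.Gamma (n + α + 1) = A at *
  generalize Real.Gamma ((0 : ℕ) + α + 1) = B at *
  generalize (n.factorial : ℝ) = F at *
  push_cast
  field_simp
  ring

lemma lagC_succ (α : ℝ) (hα : -1 < α) (n k : ℕ) (hk : k < n + 2) :
    (n + 2 : ℝ) * lagC α (n + 2) (k + 1) = (2 * n + 3 + α) * lagC α (n + 1) (k + 1)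
      - lagC α (n + 1) k - (n + 1 + α) * lagC α n (k + 1) := by
  have hn : (0 : ℝ) ≤ n := Nat.cast_nonneg n
  have hk0 : (0 : ℝ) ≤ k := Nat.cast_nonneg k
  have hka : (0 : ℝ) < k + α + 1 := by linarith
  have h1 := Gamma_pos_aux α hα k
  have hf : (0 : ℝ) < k.factorial := by exact_mod_cast Nat.factorial_pos k
  rcases (by omega : k = n + 1 ∨ k = n ∨ k + 1 ≤ n) with rfl | rfl | h
  · simp only [lagC, le_refl, if_true, Nat.sub_self, show ¬ (n + 1 + 1 ≤ n + 1) by omega,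
      show ¬ (n + 1 + 1 ≤ n) by omega, if_false, show n + 2 = n + 1 + 1 from rfl,
      Gamma_step α hα (n + 1), Nat.factorial_succ (n + 1), pow_succ, Nat.factorial_zero, Nat.cast_mul]
    generalize Real.Gamma ((n + 1 : ℕ) + α + 1) = A at *
    generalize ((n + 1).factorial : ℝ) = F at *
    push_cast at *
    field_simp
    ring
  · simp only [lagC, le_refl, if_true, Nat.sub_self, show ¬ (k + 1 ≤ k) by omega,
      if_false, show k + 1 ≤ k + 2 by omega, show k ≤ k + 1 by omega,
      show k + 2 - (k + 1) = 1 by omega, show k + 1 - k = 1 by omega,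
      Gamma_step α hα (k + 1), Gamma_step α hα k, Nat.factorial_succ k, pow_succ,
      Nat.factorial_zero, Nat.factorial_one, Nat.cast_mul]
    generalize Real.Gamma (k + α + 1) = A at *
    generalize (k.factorial : ℝ) = F at *
    push_cast
    field_simp
    ring
  · obtain ⟨j, rfl⟩ := Nat.exists_eq_add_of_le h
    have h2 := Gamma_pos_aux α hα (k + 1 + j)
    have hj : (0 : ℝ) < j.factorial := by exact_mod_cast Nat.factorial_pos j
    have hj0 : (0 : ℝ) ≤ j := Nat.cast_nonneg j
    simp only [lagC, if_true, show k + 1 ≤ k + 1 + j by omega, show k + 1 ≤ k + 1 + j + 1 by omega,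
      show k + 1 ≤ k + 1 + j + 2 by omega, show k ≤ k + 1 + j + 1 by omega,
      show k + 1 + j - (k + 1) = j by omega, show k + 1 + j + 1 - (k + 1) = j + 1 by omega,
      show k + 1 + j + 2 - (k + 1) = j + 1 + 1 by omega,
      show k + 1 + j + 1 - k = j + 1 + 1 by omega,
      Gamma_step α hα (k + 1 + j + 1), Gamma_step α hα (k + 1 + j), Gamma_step α hα k,
      Nat.factorial_succ k, Nat.factorial_succ (j + 1), Nat.factorial_succ j, pow_succ, Nat.cast_mul]
    generalize Real.Gamma (k + α + 1) = A at *
    generalize Real.Gamma ((k + 1 + j : ℕ) + α + 1) = B at *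
    generalize (k.factorial : ℝ) = F at *
    generalize (j.factorial : ℝ) = J at *
    push_cast
    field_simp
    ring

lemma genLaguerre_rec (α : ℝ) (hα : -1 < α) (n : ℕ) (x : ℝ) :
    (n + 2 : ℝ) * genLaguerre α (n + 2) x = (2 * n + 3 + α - x) * genLaguerre α (n + 1) x
      - (n + 1 + α) * genLaguerre α n x := by
  have e2 := genLaguerre_eq α (n + 2) (n + 3) (by omega) x
  have e1 := genLaguerre_eq α (n + 1) (n + 3) (by omega) x
  have e1' := genLaguerre_eq α (n + 1) (n + 2) (by omega) x
  have e0 := genLaguerre_eq α n (n + 3) (by omega) x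
  rw [Finset.sum_range_succ'] at e2 e1 e0
  have key : (n + 2 : ℝ) * ∑ k ∈ Finset.range (n + 2), lagC α (n + 2) (k + 1) * x ^ (k + 1)
      = (2 * n + 3 + α) * ∑ k ∈ Finset.range (n + 2), lagC α (n + 1) (k + 1) * x ^ (k + 1)
      - x * ∑ k ∈ Finset.range (n + 2), lagC α (n + 1) k * x ^ k
      - (n + 1 + α) * ∑ k ∈ Finset.range (n + 2), lagC α n (k + 1) * x ^ (k + 1) := by
    simp only [Finset.mul_sum]
    rw [← Finset.sum_sub_distrib, ← Finset.sum_sub_distrib]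
    apply Finset.sum_congr rfl
    intro k hk
    rw [Finset.mem_range] at hk
    have := lagC_succ α hα n k hk
    linear_combination x ^ (k + 1) * this
  rw [← e1'] at key
  have k0 := lagC_zero α hα n
  linear_combination (n + 2 : ℝ) * e2 - (2 * n + 3 + α) * e1 + (n + 1 + α) * e0 + key + k0

/-- The quadratic energy. -/
noncomputable def lagQ (α x : ℝ) (n : ℕ) : ℝ :=
  (n + 2) * (genLaguerre α (n + 1) x - genLaguerre α n x) ^ 2 + x * genLaguerre α (n + 1) x ^ 2
    - (α - 1 / 2 + x) * genLaguerre α (n + 1) x * (genLaguerre α (n + 1) x - genLaguerre α n x)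

lemma quad_nonpos (a b c D v : ℝ) (ha : a < 0) (hb : b ^ 2 < 4 * a * c) :
    a * D ^ 2 + b * (v * D) + c * v ^ 2 ≤ 0 := by
  have h : 0 ≤ (4 * a) * (a * D ^ 2 + b * (v * D) + c * v ^ 2) := by
    have : (4 * a) * (a * D ^ 2 + b * (v * D) + c * v ^ 2)
      = (2 * a * D + b * v) ^ 2 + (4 * a * c - b ^ 2) * v ^ 2 := by ring
    rw [this]
    have : 0 ≤ 4 * a * c - b ^ 2 := by linarith
    positivity
  by_contra hc
  push Not at hc
  nlinarith [mul_pos (neg_pos.2 ha) hc]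

open Filter Topology

lemma tendsto_t : Tendsto (fun n : ℕ => (Real.sqrt ((n : ℝ) + 2))⁻¹) atTop (𝓝 0) := by
  apply tendsto_inv_atTop_zero.comp
  apply Real.tendsto_sqrt_atTop.comp
  exact tendsto_atTop_add_const_right _ _ tendsto_natCast_atTop_atTop

lemma tendsto_r : Tendsto (fun n : ℕ => ((n : ℝ) + 2)⁻¹) atTop (𝓝 0) := by
  apply tendsto_inv_atTop_zero.comp
  exact tendsto_atTop_add_const_right _ _ tendsto_natCast_atTop_atTop

lemma lagQ_step (α x ε : ℝ) (hα : -1 < α) (hx : 0 < x) (hε : 0 < ε) :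
    ∀ᶠ n : ℕ in atTop,
      lagQ α x (n + 1) ≤ (1 + (α - 1 / 2 + ε) * ((n : ℝ) + 2)⁻¹) * lagQ α x n := by
  let l : ℝ := 1 - α
  let k1 : ℝ := 3 / 2 - α
  let c : ℝ := α - 1 / 2 + x
  let κ : ℝ := α - 1 / 2
  let fa : ℝ → ℝ := fun t => -ε + t ^ 2 * (l ^ 2 - 2 * l * k1) + t ^ 4 * (k1 * l ^ 2)
  let fb : ℝ → ℝ := fun t => t * (l * c - 2 * x * k1 + c * (κ + ε) + 2 * x * k1 * l * t ^ 2)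
  let fc : ℝ → ℝ := fun t => x * (k1 * x * t ^ 2 - ε)
  have ca : Continuous fa := by fun_prop
  have cd : Continuous (fun t => fb t ^ 2 - 4 * fa t * fc t) := by fun_prop
  have ha : ∀ᶠ t in 𝓝 (0 : ℝ), fa t < 0 := by
    apply ca.continuousAt.eventually_lt_const
    simp only [fa]
    norm_num
    exact hε
  have hd : ∀ᶠ t in 𝓝 (0 : ℝ), fb t ^ 2 - 4 * fa t * fc t < 0 := by
    apply cd.continuousAt.eventually_lt_const
    simp only [fa, fb, fc]
    have : 0 < ε * (x * ε) := by positivity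
    norm_num
    nlinarith
  filter_upwards [tendsto_t.eventually ha, tendsto_t.eventually hd] with n ha hd
  set t := (Real.sqrt ((n : ℝ) + 2))⁻¹ with ht
  have hn : (0 : ℝ) ≤ n := Nat.cast_nonneg n
  have hs : 0 < Real.sqrt ((n : ℝ) + 2) := Real.sqrt_pos.2 (by linarith)
  have htpos : 0 < t := inv_pos.2 hs
  have ht2 : t ^ 2 = ((n : ℝ) + 2)⁻¹ := by
    rw [ht, inv_pow, Real.sq_sqrt (by linarith)]
  have hm : (n : ℝ) + 2 = (t ^ 2)⁻¹ := by rw [ht2, inv_inv]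
  set v := genLaguerre α (n + 1) x with hv
  obtain ⟨D, hD⟩ : ∃ D, genLaguerre α (n + 1) x - genLaguerre α n x = t * D :=
    ⟨t⁻¹ * (genLaguerre α (n + 1) x - genLaguerre α n x), by field_simp⟩
  have hrec := genLaguerre_rec α hα n x
  have hD' : genLaguerre α (n + 2) x - genLaguerre α (n + 1) x
      = t * (D * (1 - l * t ^ 2) - x * v * t) := by
    have hm0 : ((n : ℝ) + 2) ≠ 0 := by linarith
    apply mul_left_cancel₀ hm0
    have hm1 : ((n : ℝ) + 2) * t ^ 2 = 1 := by rw [ht2]; field_simp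
    rw [← hv] at hD hrec ⊢
    simp only [l]
    linear_combination hrec + (n + 1 + α) * hD
      + (D * t * (1 - α) + x * v) * hm1
  have hv' : genLaguerre α (n + 2) x = v + t * (D * (1 - l * t ^ 2) - x * v * t) := by
    rw [← hD', hv]; ring
  have q := quad_nonpos (fa t) (fb t) (fc t) D v ha (by linarith)
  have hQ : lagQ α x n = D ^ 2 + x * v ^ 2 - c * t * (v * D) := by
    unfold lagQ
    rw [hD, hm, ← hv]
    simp only [c]
    field_simp
  have hQ' : lagQ α x (n + 1) = (1 + t ^ 2) * (D * (1 - l * t ^ 2) - x * v * t) ^ 2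
     + x * (v + t * (D * (1 - l * t ^ 2) - x * v * t)) ^ 2
     - c * (v + t * (D * (1 - l * t ^ 2) - x * v * t)) * (t * (D * (1 - l * t ^ 2) - x * v * t)) := by
    unfold lagQ
    rw [show n + 1 + 1 = n + 2 from rfl, hD', hv']
    have : ((n + 1 : ℕ) : ℝ) + 2 = (t ^ 2)⁻¹ + 1 := by rw [← hm]; push_cast; ring
    rw [this]
    generalize (D * (1 - l * t ^ 2) - x * v * t) = D'
    simp only [c]
    field_simp
  have hid : lagQ α x (n + 1) - (1 + (α - 1 / 2 + ε) * t ^ 2) * lagQ α x n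
     = t ^ 2 * (fa t * D ^ 2 + fb t * (v * D) + fc t * v ^ 2) := by
    rw [hQ, hQ']
    simp only [fa, fb, fc, l, k1, c, κ]
    ring
  rw [← ht2]
  have : t ^ 2 * (fa t * D ^ 2 + fb t * (v * D) + fc t * v ^ 2) ≤ 0 :=
    mul_nonpos_of_nonneg_of_nonpos (by positivity) q
  linarith

lemma lagQ_lower (α x : ℝ) (hx : 0 < x) :
    ∀ᶠ n : ℕ in atTop, x / 2 * genLaguerre α (n + 1) x ^ 2 ≤ lagQ α x n := by
  have h : ∀ᶠ n : ℕ in atTop, (α - 1 / 2 + x) ^ 2 / (2 * x) ≤ (n : ℝ) :=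
    tendsto_natCast_atTop_atTop.eventually_ge_atTop _
  filter_upwards [h] with n hn
  unfold lagQ
  generalize genLaguerre α (n + 1) x - genLaguerre α n x = d
  generalize genLaguerre α (n + 1) x = v
  generalize α - 1 / 2 + x = c at *
  have h1 : 0 ≤ (x * v - c * d) ^ 2 / (2 * x) := by positivity
  have h2 : (x * v - c * d) ^ 2 / (2 * x) = x / 2 * v ^ 2 - c * v * d + c ^ 2 / (2 * x) * d ^ 2 := by
    field_simp
    ring
  have h3 := mul_le_mul_of_nonneg_right hn (sq_nonneg d)
  nlinarith [sq_nonneg d]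

/-- The weight. -/
noncomputable def lagW (α β η : ℝ) (n : ℕ) : ℝ :=
  gamCoef β η n * ((Nat.factorial n : ℝ) / Real.Gamma (n + α + 1))

lemma lagW_pos (α β η : ℝ) (hα : -1 < α) (hβ : 0 < β) (hη : 0 < η) (n : ℕ) :
    0 < lagW α β η n := by
  have hn : (0 : ℝ) ≤ n := Nat.cast_nonneg n
  have h1 := Gamma_pos_aux α hα n
  have h2 : 0 < Real.Gamma (β + n) := Real.Gamma_pos_of_pos (by linarith)
  have h3 : 0 < Real.Gamma (β + η + n) := Real.Gamma_pos_of_pos (by linarith)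
  have h4 : 0 < Real.Gamma η := Real.Gamma_pos_of_pos hη
  have hf : (0 : ℝ) < n.factorial := by exact_mod_cast Nat.factorial_pos n
  unfold lagW gamCoef
  positivity

lemma lagW_step (α β η : ℝ) (hα : -1 < α) (hβ : 0 < β) (hη : 0 < η) (n : ℕ) :
    lagW α β η (n + 1) * ((β + η + n) * (n + α + 1)) = lagW α β η n * ((β + n) * (n + 1)) := by
  have hn : (0 : ℝ) ≤ n := Nat.cast_nonneg n
  have h1 := Gamma_pos_aux α hα n
  have h3 : 0 < Real.Gamma (β + η + n) := Real.Gamma_pos_of_pos (by linarith)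
  have e2 : Real.Gamma (β + (n + 1 : ℕ)) = (β + n) * Real.Gamma (β + n) := by
    rw [← Real.Gamma_add_one (by linarith)]
    congr 1
    push_cast
    ring
  have e3 : Real.Gamma (β + η + (n + 1 : ℕ)) = (β + η + n) * Real.Gamma (β + η + n) := by
    rw [← Real.Gamma_add_one (by linarith)]
    congr 1
    push_cast
    ring
  unfold lagW gamCoef
  rw [e2, e3, Gamma_step α hα, Nat.factorial_succ]
  have a1 : (n + α + 1 : ℝ) ≠ 0 := by linarith
  have a2 : (β + η + n : ℝ) ≠ 0 := by linarith
  push_cast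
  field_simp

lemma ratio_ev (α β η s ε : ℝ) (hs : s + ε < η + 1 / 2) :
    ∀ᶠ n : ℕ in atTop, (β + (n + 1)) * (n + 2) * (1 + (α - 1 / 2 + ε) * ((n : ℝ) + 2)⁻¹)
      ≤ (1 - s * ((n : ℝ) + 2)⁻¹) * ((β + η + (n + 1)) * ((n + 1) + α + 1)) := by
  let f : ℝ → ℝ := fun r => (η + 1 / 2 - ε - s)
    + r * ((β + η - 1) * α - s * (β + η - 1 + α) - (β - 1) * (α - 1 / 2 + ε))
    - r ^ 2 * s * ((β + η - 1) * α)
  have cf : Continuous f := by fun_prop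
  have hf : ∀ᶠ r in 𝓝 (0 : ℝ), 0 < f r := by
    apply cf.continuousAt.eventually_const_lt
    simp only [f]
    norm_num
    linarith
  filter_upwards [tendsto_r.eventually hf] with n h
  have hn : (0 : ℝ) ≤ n := Nat.cast_nonneg n
  have hm : 0 < (n : ℝ) + 2 := by linarith
  have : (1 - s * ((n : ℝ) + 2)⁻¹) * ((β + η + (n + 1)) * ((n + 1) + α + 1))
      - (β + (n + 1)) * (n + 2) * (1 + (α - 1 / 2 + ε) * ((n : ℝ) + 2)⁻¹)
      = (n + 2) * f ((n : ℝ) + 2)⁻¹ := by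
    simp only [f]
    obtain ⟨m, hmm⟩ : ∃ m : ℝ, m = (n : ℝ) + 2 := ⟨_, rfl⟩
    have hnm : (n : ℝ) = m - 2 := by linarith
    rw [← hmm] at hm ⊢
    rw [hnm]
    field_simp
    ring
  have := mul_pos hm h
  linarith

lemma one_sub_le_rpow (s m : ℝ) (hs : 0 < s) (hm : 0 < m) :
    (1 - s * m⁻¹) * (m + 1) ^ s ≤ m ^ s := by
  have h1 : (m + 1) ^ s = m ^ s * (1 + m⁻¹) ^ s := by
    rw [← Real.mul_rpow hm.le (by positivity)]
    congr 1
    field_simp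
  have h2 : (1 + m⁻¹) ^ s ≤ Real.exp (s * m⁻¹) := by
    rw [mul_comm s, Real.exp_mul]
    apply Real.rpow_le_rpow (by positivity) _ hs.le
    rw [add_comm]
    exact Real.add_one_le_exp _
  have h3 : 1 - s * m⁻¹ ≤ Real.exp (-(s * m⁻¹)) := by
    have := Real.add_one_le_exp (-(s * m⁻¹))
    linarith
  have h4 : (1 - s * m⁻¹) * (1 + m⁻¹) ^ s ≤ 1 := by
    calc _ ≤ Real.exp (-(s * m⁻¹)) * (1 + m⁻¹) ^ s :=
          mul_le_mul_of_nonneg_right h3 (by positivity)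
      _ ≤ Real.exp (-(s * m⁻¹)) * Real.exp (s * m⁻¹) :=
          mul_le_mul_of_nonneg_left h2 (by positivity)
      _ = 1 := by rw [← Real.exp_add]; simp
  rw [h1]
  have := mul_le_mul_of_nonneg_left h4 (Real.rpow_nonneg hm.le s)
  linarith

lemma decay (α β η y s : ℝ) (hα : -1 < α) (hβ : 0 < β) (hη : 0 < η) (hy : 0 < y)
    (hs0 : 0 < s) (hs : s < η + 1 / 2) :
    ∃ C : ℝ, 0 < C ∧ ∀ᶠ n : ℕ in atTop,
      lagW α β η (n + 1) * genLaguerre α (n + 1) y ^ 2 ≤ C * ((n : ℝ) + 2) ^ (-s) := by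
  obtain ⟨ε, hε, hsε⟩ : ∃ ε : ℝ, 0 < ε ∧ s + ε < η + 1 / 2 :=
    ⟨(η + 1 / 2 - s) / 2, by linarith, by linarith⟩
  obtain ⟨N, hN⟩ := eventually_atTop.1 ((lagQ_step α y ε hα hy hε).and
    ((lagQ_lower α y hy).and (ratio_ev α β η s ε hsε)))
  let H : ℕ → ℝ := fun n => lagW α β η (n + 1) * lagQ α y n * ((n : ℝ) + 2) ^ s
  have hQ0 : ∀ n, N ≤ n → 0 ≤ lagQ α y n := fun n hn =>
    le_trans (by positivity) (hN n hn).2.1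
  have hstep : ∀ n, N ≤ n → H (n + 1) ≤ H n := by
    intro n hn
    obtain ⟨h1, -, h3⟩ := hN n hn
    have hn0 : (0 : ℝ) ≤ n := Nat.cast_nonneg n
    have hW1 := lagW_pos α β η hα hβ hη (n + 1)
    have hW2 := lagW_pos α β η hα hβ hη (n + 1 + 1)
    have hW := lagW_step α β η hα hβ hη (n + 1)
    push_cast at hW
    have hP : 0 < (β + η + ((n : ℝ) + 1)) * (((n : ℝ) + 1) + α + 1) :=
      mul_pos (by linarith) (by linarith)
    have hWW : lagW α β η (n + 1 + 1) * (1 + (α - 1 / 2 + ε) * ((n : ℝ) + 2)⁻¹)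
        ≤ lagW α β η (n + 1) * (1 - s * ((n : ℝ) + 2)⁻¹) := by
      apply le_of_mul_le_mul_right _ hP
      have := mul_le_mul_of_nonneg_left h3 hW1.le
      have e : (n : ℝ) + 1 + 1 = n + 2 := by ring
      rw [e] at hW
      calc _ = (lagW α β η (n + 1 + 1) * ((β + η + ((n : ℝ) + 1)) * (((n : ℝ) + 1) + α + 1)))
              * (1 + (α - 1 / 2 + ε) * ((n : ℝ) + 2)⁻¹) := by ring
        _ = lagW α β η (n + 1) * ((β + (n + 1)) * (n + 2) * (1 + (α - 1 / 2 + ε) * ((n : ℝ) + 2)⁻¹))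
            := by rw [hW]; ring
        _ ≤ _ := by linarith
    have hr := one_sub_le_rpow s ((n : ℝ) + 2) hs0 (by linarith)
    simp only [H]
    have e : ((n + 1 : ℕ) : ℝ) + 2 = n + 2 + 1 := by push_cast; ring
    rw [e]
    have hp : 0 ≤ ((n : ℝ) + 2 + 1) ^ s := by positivity
    calc _ ≤ lagW α β η (n + 1 + 1) * ((1 + (α - 1 / 2 + ε) * ((n : ℝ) + 2)⁻¹) * lagQ α y n)
            * ((n : ℝ) + 2 + 1) ^ s := by gcongr
      _ = (lagW α β η (n + 1 + 1) * (1 + (α - 1 / 2 + ε) * ((n : ℝ) + 2)⁻¹)) *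
          (lagQ α y n * ((n : ℝ) + 2 + 1) ^ s) := by ring
      _ ≤ (lagW α β η (n + 1) * (1 - s * ((n : ℝ) + 2)⁻¹)) *
          (lagQ α y n * ((n : ℝ) + 2 + 1) ^ s) :=
          mul_le_mul_of_nonneg_right hWW (mul_nonneg (hQ0 n hn) hp)
      _ = (lagW α β η (n + 1) * lagQ α y n) *
          ((1 - s * ((n : ℝ) + 2)⁻¹) * ((n : ℝ) + 2 + 1) ^ s) := by ring
      _ ≤ _ := mul_le_mul_of_nonneg_left hr (mul_nonneg hW1.le (hQ0 n hn))
  have hbd : ∀ n, N ≤ n → H n ≤ H N := by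
    intro n hn
    induction n, hn using Nat.le_induction with
    | base => exact le_rfl
    | succ n hn ih => exact (hstep n hn).trans ih
  have hHN : 0 ≤ H N := by
    have := (lagW_pos α β η hα hβ hη (N + 1)).le
    have := hQ0 N le_rfl
    simp only [H]
    positivity
  refine ⟨2 / y * (H N + 1), by positivity, eventually_atTop.2 ⟨N, fun n hn => ?_⟩⟩
  have hn0 : (0 : ℝ) ≤ n := Nat.cast_nonneg n
  have hW1 := lagW_pos α β η hα hβ hη (n + 1)
  have hl := mul_le_mul_of_nonneg_left (hN n hn).2.1 hW1.le
  have hb := hbd n hn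
  have hps : 0 < ((n : ℝ) + 2) ^ s := by positivity
  rw [Real.rpow_neg (by linarith), ← div_eq_mul_inv, le_div_iff₀ hps]
  have hb2 := mul_le_mul_of_nonneg_right hl hps.le
  have hb3 : y / 2 * (lagW α β η (n + 1) * genLaguerre α (n + 1) y ^ 2 * ((n : ℝ) + 2) ^ s)
      ≤ H N + 1 := by
    simp only [H] at hb ⊢
    linarith
  have hb4 := mul_le_mul_of_nonneg_left hb3 (by positivity : 0 ≤ 2 / y)
  calc _ = 2 / y * (y / 2 * (lagW α β η (n + 1) * genLaguerre α (n + 1) y ^ 2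
        * ((n : ℝ) + 2) ^ s)) := by field_simp
    _ ≤ _ := hb4

/-- Schatten class membership (Proposition thmSchayyen): for `p > 4/(1+2η)` the `p`-th
powers of the singular values of `S_y^α` are summable, so `S_y^α` is of Schatten class `p`. -/
theorem stmt_16 (α β η y p : ℝ) (hα : -1 < α) (hβ : 0 < β) (hη : 0 < η) (hy : 0 < y)
    (hp : 4 / (1 + 2 * η) < p) :
    Summable fun n : ℕ => (π * gamCoef β η n * (lagPhi α n y) ^ 2) ^ (p / 2) := by
  have hp0 : 0 < p := lt_trans (by positivity) hp
  have h2 : 2 / p < η + 1 / 2 := by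
    rw [div_lt_iff₀ (by positivity)] at hp
    rw [div_lt_iff₀ hp0]
    linarith
  obtain ⟨s, hs1, hs2⟩ := exists_between h2
  have hs0 : 0 < s := lt_trans (by positivity) hs1
  have hsp : 1 < s * (p / 2) := by
    rw [div_lt_iff₀ hp0] at hs1
    linarith
  obtain ⟨C, hC, hdec⟩ := decay α β η y s hα hβ hη hy hs0 hs2
  rw [← summable_nat_add_iff 1]
  have hbase : Summable fun n : ℕ => (π * C) ^ (p / 2) * (((n + 2 : ℕ) : ℝ)) ^ (-(s * (p / 2))) := by
    apply Summable.mul_left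
    exact (summable_nat_add_iff 2).2 (Real.summable_nat_rpow.2 (by linarith))
  apply Summable.of_norm_bounded_eventually_nat hbase
  filter_upwards [hdec] with n hn
  have hn0 : (0 : ℝ) ≤ n := Nat.cast_nonneg n
  have hW := lagW_pos α β η hα hβ hη (n + 1)
  have hG := Gamma_pos_aux α hα (n + 1)
  have e : π * gamCoef β η (n + 1) * (lagPhi α (n + 1) y) ^ 2
      = π * (lagW α β η (n + 1) * genLaguerre α (n + 1) y ^ 2) := by
    unfold lagPhi lagW
    rw [mul_pow, Real.sq_sqrt (by positivity)]
    ring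
  rw [e, Real.norm_of_nonneg (by positivity)]
  calc _ ≤ (π * (C * ((n : ℝ) + 2) ^ (-s))) ^ (p / 2) := by gcongr
    _ = _ := by
      rw [← mul_assoc, Real.mul_rpow (by positivity) (by positivity), ← Real.rpow_mul (by linarith)]
      push_cast
      ring_nf
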